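/- Let p ≥ 3 be an odd integer, let k = 2p, and define L : ℤ × ℤ → ℤ by L(x,y) = ((2p+1)·x + (3p²+4p+2)·y) mod ((3p³+5p²+5p+1)/2). Then for all distinct (x₁,y₁) and (x₂,y₂) in ℤ × ℤ, |L(x₁,y₁) - L(x₂,y₂)| ≥ k + 1 - (|x₁ - x₂| + |y₁ - y₂|). In particular, L is a λ-L(k, k-1, …, 2, 1)-labeling of the square grid with λ = (3p³+5p²+5p+1)/2. -/

import Mathlib

/-- A linear form with coefficients of size at most `M` is bounded by `M` times the
`ℓ¹`-norm. -/
theorem abs_linear_form_le (α β γ x y z M : ℤ) (hα : |α| ≤ M) (hβ : |β| ≤ M) (hγ : |γ| ≤ M) :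
    |α * x + β * y + γ * z| ≤ M * (|x| + |y| + |z|) := by
  calc |α * x + β * y + γ * z| ≤ |α * x| + |β * y| + |γ * z| := abs_add_three _ _ _
    _ = |α| * |x| + |β| * |y| + |γ| * |z| := by simp only [abs_mul]
    _ ≤ M * |x| + M * |y| + M * |z| := by gcongr
    _ = M * (|x| + |y| + |z|) := by ring

/-- If `c * t` is a linear form in `(x, y, z)` with coefficients of size at most `M`, and
`(x, y, z)` has `ℓ¹`-norm at most `N` with `M * N < c * (n + 1)`, then `|t| ≤ n`. -/
theorem abs_coord_le {c t α β γ x y z M N n : ℤ} (hc : 0 < c)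
    (ht : c * t = α * x + β * y + γ * z) (hα : |α| ≤ M) (hβ : |β| ≤ M) (hγ : |γ| ≤ M)
    (hN : |x| + |y| + |z| ≤ N) (h : M * N < c * (n + 1)) : |t| ≤ n := by
  have hM : 0 ≤ M := (abs_nonneg α).trans hα
  have h₁ : c * |t| ≤ M * N := by
    rw [show c * |t| = |c * t| by rw [abs_mul, abs_of_pos hc], ht]
    exact (abs_linear_form_le α β γ x y z M hα hβ hγ).trans (by gcongr)
  exact Int.lt_add_one_iff.mp (lt_of_mul_lt_mul_left (h₁.trans_lt h) hc.le)

/-- The lattice spanned by `(-(q+1), q+1, -(2q+1))`, `(-q, q+1, 2q+2)` and `(1, 3q+2, -q)` has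
no nonzero vector of `ℓ¹`-norm less than `4q+3`. -/
theorem coords_eq_zero_of_norm_lt {q i j l x y z : ℤ} (hq : 1 ≤ q)
    (hx : x = -(q + 1) * i - q * j + l)
    (hy : y = (q + 1) * i + (q + 1) * j + (3 * q + 2) * l)
    (hz : z = -(2 * q + 1) * i + (2 * q + 2) * j - q * l)
    (h : |x| + |y| + |z| ≤ 4 * q + 2) : i = 0 ∧ j = 0 ∧ l = 0 := by
  have hc : 0 < 12 * q ^ 3 + 28 * q ^ 2 + 24 * q + 7 := by positivity
  have hl : |l| ≤ 1 := by
    refine abs_coord_le (α := (q + 1) * (4 * q + 3)) (β := 4 * q ^ 2 + 5 * q + 2)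
      (γ := -(q + 1)) (M := (q + 1) * (4 * q + 3)) hc ?_ ?_ ?_ ?_ h ?_
    · subst hx hy hz; ring
    all_goals first | (rw [abs_le]; constructor <;> nlinarith) | nlinarith [pow_pos (zero_lt_one.trans_le hq) 3]
  have hi : |i| ≤ 2 := by
    refine abs_coord_le (α := -((q + 1) * (7 * q + 4))) (β := 2 * q + 2 - q ^ 2)
      (γ := -(3 * q ^ 2 + 3 * q + 1)) (M := (q + 1) * (7 * q + 4)) hc ?_ ?_ ?_ ?_ h ?_
    · subst hx hy hz; ring
    all_goals first | (rw [abs_le]; constructor <;> nlinarith) | nlinarith [pow_pos (zero_lt_one.trans_le hq) 3]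
  have hj : |j| ≤ 1 := by
    refine abs_coord_le (α := -(5 * q ^ 2 + 6 * q + 2)) (β := q ^ 2 + 3 * q + 1)
      (γ := (3 * q + 3) * (q + 1)) (M := 5 * q ^ 2 + 6 * q + 2) hc ?_ ?_ ?_ ?_ h ?_
    · subst hx hy hz; ring
    all_goals first | (rw [abs_le]; constructor <;> nlinarith) | nlinarith [pow_pos (zero_lt_one.trans_le hq) 3]
  have hx₁ := le_abs_self x
  have hx₂ := neg_le_abs x
  have hy₁ := le_abs_self y
  have hy₂ := neg_le_abs y
  have hz₁ := le_abs_self z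
  have hz₂ := neg_le_abs z
  rw [abs_le] at hi hj hl
  obtain ⟨hi₁, hi₂⟩ := hi
  obtain ⟨hj₁, hj₂⟩ := hj
  obtain ⟨hl₁, hl₂⟩ := hl
  generalize |x| = X at *
  generalize |y| = Y at *
  generalize |z| = Z at *
  interval_cases i <;> interval_cases j <;> interval_cases l <;> omega

/-- With `p = 2q+1`, the integer vectors `(x, y, a x + b y - c m)` have `ℓ¹`-norm at least
`2p+1` unless `x = y = 0`. -/
theorem eq_zero_of_norm_le {q x y m : ℤ} (hq : 1 ≤ q)
    (h : |x| + |y| + |(4 * q + 3) * x + (12 * q ^ 2 + 20 * q + 9) * y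
      - (12 * q ^ 3 + 28 * q ^ 2 + 24 * q + 7) * m| ≤ 4 * q + 2) : x = 0 ∧ y = 0 := by
  obtain ⟨l, hl⟩ : ∃ l, l = (q + 1) * m - y := ⟨_, rfl⟩
  obtain ⟨i, hi⟩ : ∃ i, i = l - q * (m - 3 * l) - x := ⟨_, rfl⟩
  obtain ⟨j, hj⟩ : ∃ j, j = m - 3 * l - i := ⟨_, rfl⟩
  have hx : x = -(q + 1) * i - q * j + l := by rw [hj, hi]; ring
  have hy : y = (q + 1) * i + (q + 1) * j + (3 * q + 2) * l := by rw [hj, hl]; ring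
  obtain ⟨rfl, rfl, rfl⟩ := coords_eq_zero_of_norm_lt hq hx hy
    (by rw [hj, hi, hl]; ring) h
  simp [hx, hy]


/-- For odd `p ≥ 3` and `k = 2p`, the formula
`L(x,y) = ((2p+1)x + (3p²+4p+2)y) mod ((3p³+5p²+5p+1)/2)` is a
`λ`-`L(k, k-1, …, 2, 1)`-labeling of the square grid with
`λ = (3p³+5p²+5p+1)/2`. -/
theorem formula_even_k_odd_p (p : ℤ) (hp : 3 ≤ p) (hodd : Odd p)
    (k : ℤ) (hk : k = 2 * p)
    (L : ℤ × ℤ → ℤ)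
    (hL : ∀ v : ℤ × ℤ,
      L v = ((2 * p + 1) * v.1 + (3 * p ^ 2 + 4 * p + 2) * v.2) %
        ((3 * p ^ 3 + 5 * p ^ 2 + 5 * p + 1) / 2)) :
    (∀ u v : ℤ × ℤ, u ≠ v →
      k + 1 - (|u.1 - v.1| + |u.2 - v.2|) ≤ |L u - L v|) ∧
    (∀ v : ℤ × ℤ, 0 ≤ L v ∧ L v ≤ (3 * p ^ 3 + 5 * p ^ 2 + 5 * p + 1) / 2 - 1) := by
  obtain ⟨q, rfl⟩ := hodd
  have hq : 1 ≤ q := by omega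
  have hdiv : (3 * (2 * q + 1) ^ 3 + 5 * (2 * q + 1) ^ 2 + 5 * (2 * q + 1) + 1) / 2
      = 12 * q ^ 3 + 28 * q ^ 2 + 24 * q + 7 :=
    Int.ediv_eq_of_eq_mul_right two_ne_zero (by ring)
  rw [hdiv] at hL ⊢
  have hc : 0 < 12 * q ^ 3 + 28 * q ^ 2 + 24 * q + 7 := by positivity
  refine ⟨fun u v huv => ?_, fun v => ?_⟩
  · by_contra! hlt
    refine huv ?_
    rw [hL, hL, Int.emod_def, Int.emod_def] at hlt
    generalize ((2 * (2 * q + 1) + 1) * u.1 + (3 * (2 * q + 1) ^ 2 + 4 * (2 * q + 1) + 2) * u.2) /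
      (12 * q ^ 3 + 28 * q ^ 2 + 24 * q + 7) = s at hlt
    generalize ((2 * (2 * q + 1) + 1) * v.1 + (3 * (2 * q + 1) ^ 2 + 4 * (2 * q + 1) + 2) * v.2) /
      (12 * q ^ 3 + 28 * q ^ 2 + 24 * q + 7) = t at hlt
    obtain ⟨h₁, h₂⟩ := eq_zero_of_norm_le (x := u.1 - v.1) (y := u.2 - v.2) (m := s - t) hq (by
      ring_nf at hlt ⊢
      linarith)
    exact Prod.ext (sub_eq_zero.mp h₁) (sub_eq_zero.mp h₂)
  · rw [hL]
    exact ⟨Int.emod_nonneg _ hc.ne', Int.le_sub_one_of_lt (Int.emod_lt_of_pos _ hc)⟩
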